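/- arXiv:2504.02236 — 2 statements merged into one kernel-verified Lean document; each statement's English description precedes it below -/
import Mathlib

section
/- Let h > 0, z ∈ ℂ, and let p, q : ℝ → ℂ be continuous, 1-periodic (p(x+1) = p(x), q(x+1) = q(x)) and even (p(−x) = p(x), q(−x) = q(x)). Suppose Y : ℝ → Matrix (Fin 2) (Fin 2) ℂ is differentiable with h·Y'(x) = A(x; z)·Y(x) for all x and Y(0) = I, and W : ℝ → Matrix (Fin 2) (Fin 2) ℂ is differentiable with h·W'(x) = A(x; −z)·W(x) for all x and W(0) = I. Then σ₃·W(1)·σ₃·Y(1) = I, where σ₃ = diag(1, −1); that is, the monodromy matrices satisfy M(−z; h) = σ₃·M(z; h)⁻¹·σ₃. -/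
open Complex Matrix

/-- `U` solves the linear system `U' = A U`, with derivatives taken entrywise. -/
def SolvesLinear (A U : ℝ → Matrix (Fin 2) (Fin 2) ℂ) : Prop :=
  ∀ x i j, HasDerivAt (fun t => U t i j) ((A x * U x) i j) x

/-- For a trace-free system, the adjugate of a solution times another solution is constant. -/
theorem SolvesLinear.adjugate_mul_const {A U V : ℝ → Matrix (Fin 2) (Fin 2) ℂ}
    (hA : ∀ x, (A x).trace = 0) (hU : SolvesLinear A U) (hV : SolvesLinear A V) (x y : ℝ) :
    (U x).adjugate * V x = (U y).adjugate * V y := by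
  have key : ∀ i j t, HasDerivAt (fun s => ((U s).adjugate * V s) i j) 0 t := by
    intro i j t
    have htr : A t 1 1 = -A t 0 0 := by
      have := hA t
      rw [trace_fin_two] at this
      linear_combination this
    fin_cases i
    · refine ((((hU t 1 1).mul (hV t 0 j)).sub ((hU t 0 1).mul (hV t 1 j))).congr_deriv
        ?_).congr_of_eventuallyEq (.of_forall fun s => ?_)
      · simp only [mul_apply, Fin.sum_univ_two, htr]
        ring
      · simp [adjugate_fin_two, mul_apply, sub_eq_add_neg]
    · refine ((((hU t 0 0).mul (hV t 1 j)).sub ((hU t 1 0).mul (hV t 0 j))).congr_deriv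
        ?_).congr_of_eventuallyEq (.of_forall fun s => ?_)
      · simp only [mul_apply, Fin.sum_univ_two, htr]
        ring
      · simp [adjugate_fin_two, mul_apply, sub_eq_add_neg, add_comm]
  ext i j
  exact is_const_of_deriv_eq_zero (fun t => (key i j t).differentiableAt)
    (fun t => (key i j t).deriv) x y

/-- Solutions of a trace-free system normalized at `0` have determinant one. -/
theorem SolvesLinear.det_eq_one {A U : ℝ → Matrix (Fin 2) (Fin 2) ℂ}
    (hA : ∀ x, (A x).trace = 0) (hU : SolvesLinear A U) (hU0 : U 0 = 1) (x : ℝ) :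
    (U x).det = 1 := by
  have := hU.adjugate_mul_const hA hU x 0
  rw [adjugate_mul, hU0, adjugate_one, one_mul] at this
  simpa using congrFun (congrFun this 0) 0

/-- Two solutions of a trace-free system normalized at `0` agree. -/
theorem SolvesLinear.eq_of_normalized {A U V : ℝ → Matrix (Fin 2) (Fin 2) ℂ}
    (hA : ∀ x, (A x).trace = 0) (hU : SolvesLinear A U) (hV : SolvesLinear A V)
    (hU0 : U 0 = 1) (hV0 : V 0 = 1) (x : ℝ) : V x = U x := by
  have hc := hU.adjugate_mul_const hA hV x 0
  rw [hU0, hV0, adjugate_one, one_mul] at hc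
  calc V x = U x * (U x).adjugate * V x := by
        rw [mul_adjugate, hU.det_eq_one hA hU0, one_smul, one_mul]
    _ = U x := by rw [mul_assoc, hc, mul_one]

/-- For a 1-periodic trace-free system, the normalized solution satisfies `U 1 * U (-1) = 1`. -/
theorem SolvesLinear.mul_neg_one_eq_one {A U : ℝ → Matrix (Fin 2) (Fin 2) ℂ}
    (hA : ∀ x, (A x).trace = 0) (hper : ∀ x, A (x + 1) = A x) (hU : SolvesLinear A U)
    (hU0 : U 0 = 1) : U 1 * U (-1) = 1 := by
  have hshift : SolvesLinear A fun x => U (x + -1) := by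
    intro x i j
    have hx : A x = A (x + -1) := by simpa using hper (x + -1)
    rw [hx]
    exact (hU (x + -1) i j).comp_add_const x (-1)
  have hc := hU.adjugate_mul_const hA hshift 1 0
  simp only [add_neg_cancel, zero_add, hU0, adjugate_one, one_mul, mul_one] at hc
  rw [← hc, mul_adjugate, hU.det_eq_one hA hU0, one_smul]

/-- The coefficient matrix of the Dirac system, divided by `h`. -/
noncomputable def diracCoeff (h z : ℂ) (p q : ℝ → ℂ) (x : ℝ) : Matrix (Fin 2) (Fin 2) ℂ :=
  h⁻¹ • !![-Complex.I * z, q x; p x, Complex.I * z]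

theorem trace_diracCoeff (h z : ℂ) (p q : ℝ → ℂ) (x : ℝ) : (diracCoeff h z p q x).trace = 0 := by
  simp [diracCoeff, trace_fin_two]

theorem solvesLinear_diracCoeff {h z : ℂ} {p q : ℝ → ℂ} (hh : h ≠ 0)
    {Y : ℝ → Matrix (Fin 2) (Fin 2) ℂ} (hdiff : ∀ i j, Differentiable ℝ fun x => Y x i j)
    (hode : ∀ x, ∀ i j, h * deriv (fun t => Y t i j) x
      = (!![-Complex.I * z, q x; p x, Complex.I * z] * Y x) i j) :
    SolvesLinear (diracCoeff h z p q) Y := by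
  intro x i j
  refine (hdiff i j x).hasDerivAt.congr_deriv ?_
  rw [diracCoeff, smul_mul, Matrix.smul_apply, ← hode, smul_eq_mul, inv_mul_cancel_left₀ hh]

/-- For even coefficients, reflection in `x` and conjugation by `σ₃` turn solutions at `-z` into
solutions at `z`. -/
theorem SolvesLinear.reflect {h z : ℂ} {p q : ℝ → ℂ}
    (hpe : ∀ x, p (-x) = p x) (hqe : ∀ x, q (-x) = q x) {W : ℝ → Matrix (Fin 2) (Fin 2) ℂ}
    (hW : SolvesLinear (diracCoeff h (-z) p q) W) :
    SolvesLinear (diracCoeff h z p q)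
      fun x => !![(1 : ℂ), 0; 0, -1] * W (-x) * !![(1 : ℂ), 0; 0, -1] := by
  intro x i j
  have hneg : ∀ i j, HasDerivAt (fun t => W (-t) i j)
      (-(diracCoeff h (-z) p q (-x) * W (-x)) i j) x := by
    intro i j
    simpa [Function.comp_def] using (hW (-x) i j).scomp x (hasDerivAt_neg x)
  have hconj : ∀ M : Matrix (Fin 2) (Fin 2) ℂ,
      !![(1 : ℂ), 0; 0, -1] * M * !![(1 : ℂ), 0; 0, -1]
        = !![M 0 0, -M 0 1; -M 1 0, M 1 1] := by
    intro M
    ext i j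
    fin_cases i <;> fin_cases j <;> simp [mul_apply, vecMul, dotProduct]
  simp only [hconj]
  fin_cases i <;> fin_cases j
  · refine (hneg 0 0).congr_deriv ?_
    simp [diracCoeff, mul_apply, hpe, hqe]
    ring
  · refine (hneg 0 1).neg.congr_deriv ?_
    simp [diracCoeff, mul_apply, hpe, hqe]
  · refine (hneg 1 0).neg.congr_deriv ?_
    simp [diracCoeff, mul_apply, hpe, hqe]
  · refine (hneg 1 1).congr_deriv ?_
    simp [diracCoeff, mul_apply, hpe, hqe]
    ring

/-- For continuous, 1-periodic, even p, q, the normalized solutions at z and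
−z satisfy σ₃·W(1)·σ₃·Y(1) = I, i.e. M(−z;h) = σ₃·M(z;h)⁻¹·σ₃. -/
theorem stmt_4 (h : ℝ) (hh : 0 < h) (z : ℂ) (p q : ℝ → ℂ)
    (hpc : Continuous p) (hqc : Continuous q)
    (hpper : ∀ x, p (x + 1) = p x) (hqper : ∀ x, q (x + 1) = q x)
    (hpe : ∀ x, p (-x) = p x) (hqe : ∀ x, q (-x) = q x)
    (Y W : ℝ → Matrix (Fin 2) (Fin 2) ℂ)
    (hYdiff : ∀ i j, Differentiable ℝ fun x => Y x i j)
    (hYode : ∀ x, ∀ i j, (h : ℂ) * deriv (fun t => Y t i j) x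
      = (!![-Complex.I * z, q x; p x, Complex.I * z] * Y x) i j)
    (hY0 : Y 0 = 1)
    (hWdiff : ∀ i j, Differentiable ℝ fun x => W x i j)
    (hWode : ∀ x, ∀ i j, (h : ℂ) * deriv (fun t => W t i j) x
      = (!![-Complex.I * (-z), q x; p x, Complex.I * (-z)] * W x) i j)
    (hW0 : W 0 = 1) :
    !![(1 : ℂ), 0; 0, -1] * W 1 * !![(1 : ℂ), 0; 0, -1] * Y 1 = 1 := by
  have hh' : (h : ℂ) ≠ 0 := by exact_mod_cast hh.ne'
  have hY := solvesLinear_diracCoeff hh' hYdiff hYode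
  have hW := solvesLinear_diracCoeff hh' hWdiff hWode
  have hσ : !![(1 : ℂ), 0; 0, -1] * !![(1 : ℂ), 0; 0, -1] = 1 := by
    simp [one_fin_two]
  have hper : ∀ x, diracCoeff h (-z) p q (x + 1) = diracCoeff h (-z) p q x := by
    simp [diracCoeff, hpper, hqper]
  have hinv := hW.mul_neg_one_eq_one (trace_diracCoeff _ _ _ _) hper hW0
  have hYW := hY.eq_of_normalized (trace_diracCoeff _ _ _ _) (hW.reflect hpe hqe) hY0
    (by simp [hW0, hσ]) 1
  rw [← hYW]
  generalize !![(1 : ℂ), 0; 0, -1] = σ at hσ ⊢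
  calc σ * W 1 * σ * (σ * W (-1) * σ) = σ * (W 1 * (σ * σ) * W (-1)) * σ := by
        simp only [mul_assoc]
    _ = 1 := by rw [hσ, mul_one, hinv, mul_one, hσ]
end

section
/- Let h > 0 and c > 0 be real numbers, let z ∈ ℂ, and let λ ∈ ℂ satisfy λ² = z² − c². Then the complex number cos(λ/h) is real and lies in the interval [−1, 1] (i.e., Im(cos(λ/h)) = 0 and |Re(cos(λ/h))| ≤ 1) if and only if z is real with |Re z| ≥ c (i.e., Im z = 0 and c ≤ |Re z|). (This identifies the conditional stability set {z : Δ(z) ∈ [−1,1]} of the constant-potential Dirac system with p₀ = conj(q₀), c = |q₀|, as (−∞, −c] ∪ [c, ∞).) -/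
open Complex

/-- The complex cosine takes a value in `[-1, 1]` exactly at the real points. -/
theorem cos_mem_Icc_iff_im_eq_zero (w : ℂ) :
    ((Complex.cos w).im = 0 ∧ |(Complex.cos w).re| ≤ 1) ↔ w.im = 0 := by
  constructor
  · rintro ⟨him, hre⟩
    obtain ⟨hl, hr⟩ := abs_le.mp hre
    have hcos : Complex.cos ((Real.arccos (Complex.cos w).re : ℝ) : ℂ) = Complex.cos w := by
      rw [← Complex.ofReal_cos, Real.cos_arccos hl hr]
      exact Complex.ext (by simp) (by simp [him])
    obtain ⟨k, hk | hk⟩ := Complex.cos_eq_cos_iff.mp hcos <;> rw [hk] <;> simp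
  · intro hw
    have hreal : w = (w.re : ℂ) := Complex.ext (by simp) (by simp [hw])
    rw [hreal, ← Complex.ofReal_cos]
    exact ⟨Complex.ofReal_im _, (Complex.ofReal_re (Real.cos w.re)).symm ▸ Real.abs_cos_le_one w.re⟩

/-- For h > 0, c > 0 and λ² = z² − c², the Floquet discriminant
cos(λ/h) is real and in [−1,1] iff z is real with |Re z| ≥ c. This identifies the
conditional stability set for p₀ = conj(q₀), c = |q₀| as (−∞,−c] ∪ [c,∞). -/
theorem stmt_19 (h c : ℝ) (hh : 0 < h) (hc : 0 < c) (z lam : ℂ)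
    (hlam : lam ^ 2 = z ^ 2 - (c : ℂ) ^ 2) :
    ((Complex.cos (lam / h)).im = 0 ∧ |(Complex.cos (lam / h)).re| ≤ 1) ↔
      (z.im = 0 ∧ c ≤ |z.re|) := by
  have hdiv : (lam / h).im = 0 ↔ lam.im = 0 := by
    rw [Complex.div_ofReal_im, div_eq_zero_iff]
    simp [hh.ne']
  rw [cos_mem_Icc_iff_im_eq_zero, hdiv]
  have hre := congrArg Complex.re hlam
  have him := congrArg Complex.im hlam
  simp only [pow_two, Complex.sub_re, Complex.sub_im, Complex.mul_re, Complex.mul_im,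
    Complex.ofReal_re, Complex.ofReal_im] at hre him
  constructor
  · intro hb
    rw [hb] at hre him
    have hxy : z.re * z.im = 0 := by linarith
    have hy : z.im = 0 := by
      rcases mul_eq_zero.mp hxy with hx | hy
      · rw [hx] at hre
        nlinarith [mul_self_nonneg lam.re, mul_self_nonneg z.im, mul_pos hc hc]
      · exact hy
    refine ⟨hy, ?_⟩
    rw [hy] at hre
    rw [← abs_of_pos hc]
    exact sq_le_sq.mp (by nlinarith [mul_self_nonneg lam.re])
  · rintro ⟨hy, hx⟩
    rw [← abs_of_pos hc] at hx
    have hsq := sq_le_sq.mpr hx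
    rw [hy] at hre him
    have hab : lam.re * lam.im = 0 := by linarith
    rcases mul_eq_zero.mp hab with ha | hb
    · rw [ha] at hre
      exact mul_self_eq_zero.mp (by nlinarith [mul_self_nonneg lam.im])
    · exact hb
end
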